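/- Let Ξ ∈ ℝ^{2×2} be invertible with columns ξ₁, ξ₂ and set ξ₃ = ξ₁ + ξ₂. Let φ be the Cartesian box spline φ(x) = max(1 + min(x₁, x₂, 0) − max(x₁, x₂, 0), 0). Then the Fourier transform of the function B_Ξ(x) = φ(Ξ⁻¹x) is B̂_Ξ(ω) = |det Ξ| · ∏_{r=1}^{3} sinc(ξᵣᵀω / 2) for all ω ∈ ℝ². -/

import Mathlib

open MeasureTheory

/-- The Cartesian (CPWL) box spline `φ(x) = max(1 + min(x₁,x₂,0) − max(x₁,x₂,0), 0)`. -/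
noncomputable def boxSpline (x : ℝ × ℝ) : ℝ :=
  max (1 + min (min x.1 x.2) 0 - max (max x.1 x.2) 0) 0

/-- `sinc t = sin t / t` for `t ≠ 0`, and `sinc 0 = 1`. -/
noncomputable def sinc (t : ℝ) : ℝ := if t = 0 then 1 else Real.sin t / t

/-- Two-dimensional Fourier transform `f̂(ω) = ∫_{ℝ²} f(x) e^{−i⟨ω,x⟩} dx`. -/
noncomputable def ft2 (f : ℝ × ℝ → ℝ) (ω : ℝ × ℝ) : ℂ :=
  ∫ x : ℝ × ℝ, (f x : ℂ) * Complex.exp (-Complex.I * ((ω.1 * x.1 + ω.2 * x.2 : ℝ) : ℂ))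

/-- The modulated indicator `u ↦ 1_{[-1/2, 1/2]}(u) e^{-iau}`. -/
noncomputable def modulatedBox (a u : ℝ) : ℂ :=
  (Set.Icc (-1 / 2 : ℝ) (1 / 2)).indicator
    (fun u : ℝ => Complex.exp (-Complex.I * ((a * u : ℝ) : ℂ))) u

lemma measurable_modulatedBox (a : ℝ) : Measurable (modulatedBox a) := by
  unfold modulatedBox
  exact Measurable.indicator (by fun_prop) measurableSet_Icc

lemma norm_exp_neg_I_mul_ofReal (r : ℝ) : ‖Complex.exp (-Complex.I * (r : ℂ))‖ = 1 := by
  simp [Complex.norm_exp]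

lemma norm_modulatedBox_le (a u : ℝ) : ‖modulatedBox a u‖ ≤ 1 := by
  unfold modulatedBox
  refine (norm_indicator_le_norm_self _ _).trans ?_
  rw [norm_exp_neg_I_mul_ofReal]

lemma modulatedBox_of_notMem {a u : ℝ} (hu : u ∉ Set.Icc (-1 / 2 : ℝ) (1 / 2)) :
    modulatedBox a u = 0 :=
  Set.indicator_of_notMem hu _

lemma integral_modulatedBox (a : ℝ) : ∫ u, modulatedBox a u = (sinc (a / 2) : ℂ) := by
  unfold modulatedBox
  rw [integral_indicator measurableSet_Icc, integral_Icc_eq_integral_Ioc,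
    ← intervalIntegral.integral_of_le (by norm_num)]
  rcases eq_or_ne a 0 with rfl | ha
  · norm_num [sinc]
  have hc : -Complex.I * (a : ℂ) ≠ 0 := by simp [ha]
  have h := integral_exp_mul_complex (a := -1 / 2) (b := 1 / 2) hc
  have hcong : ∀ u : ℝ, Complex.exp (-Complex.I * ((a * u : ℝ) : ℂ))
      = Complex.exp (-Complex.I * (a : ℂ) * u) := fun u => by push_cast; ring_nf
  simp_rw [hcong]
  rw [h, sinc, if_neg (by positivity)]
  push_cast
  rw [Complex.sin]
  have ha' : (a : ℂ) ≠ 0 := by exact_mod_cast ha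
  have e1 : -Complex.I * (a : ℂ) * (1 / 2) = -(a / 2 : ℂ) * Complex.I := by ring
  have e2 : -Complex.I * (a : ℂ) * (-1 / 2) = (a / 2 : ℂ) * Complex.I := by ring
  rw [e1, e2]
  field_simp
  linear_combination (Complex.exp ((a : ℂ) * Complex.I / 2)
    - Complex.exp (-((a : ℂ) * Complex.I / 2))) * Complex.I_sq

/-- The box spline, modulated, is the directional convolution of three modulated boxes. -/
lemma integral_modulatedBox_mul (a b : ℝ) (x : ℝ × ℝ) :
    ∫ t, modulatedBox a (x.1 - t) * modulatedBox b (x.2 - t) * modulatedBox (a + b) t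
      = (boxSpline x : ℂ) * Complex.exp (-Complex.I * ((a * x.1 + b * x.2 : ℝ) : ℂ)) := by
  have key : (fun t => modulatedBox a (x.1 - t) * modulatedBox b (x.2 - t)
        * modulatedBox (a + b) t)
      = (Set.Icc (max (max x.1 x.2) 0 - 1 / 2) (min (min x.1 x.2) 0 + 1 / 2)).indicator
        (fun _ => Complex.exp (-Complex.I * ((a * x.1 + b * x.2 : ℝ) : ℂ))) := by
    funext t
    have hmem : t ∈ Set.Icc (max (max x.1 x.2) 0 - 1 / 2) (min (min x.1 x.2) 0 + 1 / 2) ↔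
        x.1 - t ∈ Set.Icc (-1 / 2 : ℝ) (1 / 2) ∧ x.2 - t ∈ Set.Icc (-1 / 2 : ℝ) (1 / 2) ∧
          t ∈ Set.Icc (-1 / 2 : ℝ) (1 / 2) := by
      simp only [Set.mem_Icc, sub_le_iff_le_add, max_le_iff,
        ← min_add_add_right, le_min_iff]
      constructor <;> intro h <;> refine ⟨?_, ?_, ?_⟩ <;> (try constructor) <;>
        (try constructor) <;> linarith [h.1, h.2]
    by_cases ht : t ∈ Set.Icc (max (max x.1 x.2) 0 - 1 / 2) (min (min x.1 x.2) 0 + 1 / 2)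
    · obtain ⟨h1, h2, h3⟩ := hmem.1 ht
      simp only [modulatedBox]
      rw [Set.indicator_of_mem ht, Set.indicator_of_mem h1, Set.indicator_of_mem h2,
        Set.indicator_of_mem h3, ← Complex.exp_add, ← Complex.exp_add]
      push_cast
      ring_nf
    · rw [Set.indicator_of_notMem ht]
      rw [hmem, not_and_or, not_and_or] at ht
      rcases ht with h | h | h <;> simp [modulatedBox_of_notMem h]
  rw [key, integral_indicator_const _ measurableSet_Icc, Real.volume_real_Icc, boxSpline,
    Complex.real_smul]
  ring_nf

lemma integrable_modulatedBox_mul (a b c : ℝ) :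
    Integrable (fun p : (ℝ × ℝ) × ℝ =>
      modulatedBox a (p.1.1 - p.2) * modulatedBox b (p.1.2 - p.2) * modulatedBox c p.2)
      ((volume : Measure (ℝ × ℝ)).prod volume) := by
  have hmeas : Measurable (fun p : (ℝ × ℝ) × ℝ =>
      modulatedBox a (p.1.1 - p.2) * modulatedBox b (p.1.2 - p.2) * modulatedBox c p.2) :=
    (((measurable_modulatedBox a).comp (by fun_prop)).mul
      ((measurable_modulatedBox b).comp (by fun_prop))).mul
      ((measurable_modulatedBox c).comp (by fun_prop))
  rw [← integrableOn_iff_integrable_of_support_subset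
    (s := Set.Icc (((-1, -1), -1) : (ℝ × ℝ) × ℝ) ((1, 1), 1))]
  · refine Measure.integrableOn_of_bounded (M := 1)
      (isCompact_Icc.measure_lt_top (μ := (volume : Measure ((ℝ × ℝ) × ℝ)))).ne
      hmeas.aestronglyMeasurable (Filter.Eventually.of_forall fun p => ?_)
    rw [norm_mul, norm_mul]
    exact mul_le_one₀ (mul_le_one₀ (norm_modulatedBox_le _ _) (norm_nonneg _)
      (norm_modulatedBox_le _ _)) (norm_nonneg _) (norm_modulatedBox_le _ _)
  · intro p hp
    rw [Function.mem_support] at hp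
    have h3 : p.2 ∈ Set.Icc (-1 / 2 : ℝ) (1 / 2) := by
      by_contra h; simp [modulatedBox_of_notMem h] at hp
    have h2 : p.1.2 - p.2 ∈ Set.Icc (-1 / 2 : ℝ) (1 / 2) := by
      by_contra h; simp [modulatedBox_of_notMem h] at hp
    have h1 : p.1.1 - p.2 ∈ Set.Icc (-1 / 2 : ℝ) (1 / 2) := by
      by_contra h; simp [modulatedBox_of_notMem h] at hp
    simp only [Set.mem_Icc] at h1 h2 h3
    refine ⟨⟨⟨?_, ?_⟩, ?_⟩, ⟨⟨?_, ?_⟩, ?_⟩⟩ <;> dsimp only <;> linarith [h1.1, h1.2, h2.1, h2.2]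

/-- The Fourier transform of the Cartesian box spline. -/
theorem ft2_boxSpline (ω : ℝ × ℝ) :
    ft2 boxSpline ω
      = ((sinc (ω.1 / 2) * sinc (ω.2 / 2) * sinc ((ω.1 + ω.2) / 2) : ℝ) : ℂ) := by
  unfold ft2
  simp_rw [← integral_modulatedBox_mul]
  rw [integral_integral_swap (integrable_modulatedBox_mul ω.1 ω.2 (ω.1 + ω.2))]
  simp_rw [integral_mul_const]
  have h (t : ℝ) : ∫ x : ℝ × ℝ, modulatedBox ω.1 (x.1 - t) * modulatedBox ω.2 (x.2 - t)
      = (sinc (ω.1 / 2) * sinc (ω.2 / 2) : ℂ) := by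
    rw [Measure.volume_eq_prod, integral_prod_mul (fun u => modulatedBox ω.1 (u - t))
      (fun u => modulatedBox ω.2 (u - t)), integral_sub_right_eq_self,
      integral_sub_right_eq_self, integral_modulatedBox, integral_modulatedBox]
  simp_rw [h]
  rw [integral_const_mul, integral_modulatedBox]
  push_cast
  rfl

/-- Linear change of variables in the plane. -/
lemma integral_eq_abs_det_smul_integral_mulVec {E : Type*} [NormedAddCommGroup E]
    [NormedSpace ℝ E] (A : Matrix (Fin 2) (Fin 2) ℝ) (hA : IsUnit A.det) (g : ℝ × ℝ → E) :
    ∫ x, g x = |A.det| • ∫ y : ℝ × ℝ, g ((A.mulVec ![y.1, y.2]) 0, (A.mulVec ![y.1, y.2]) 1) := by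
  set L := Matrix.toLin (Module.Basis.finTwoProd ℝ) (Module.Basis.finTwoProd ℝ) A with hL
  have hdet : LinearMap.det L = A.det := LinearMap.det_toLin _ _
  have hL_apply (y : ℝ × ℝ) :
      L y = ((A.mulVec ![y.1, y.2]) 0, (A.mulVec ![y.1, y.2]) 1) := by
    rw [hL, Matrix.eta_fin_two A, Matrix.toLin_finTwoProd_apply]
    simp [Matrix.mulVec, dotProduct]
  have hbij : Function.Bijective L := by
    rw [← Module.End.isUnit_iff, LinearMap.isUnit_iff_isUnit_det, hdet]
    exact hA
  have h := integral_image_eq_integral_abs_det_fderiv_smul (volume : Measure (ℝ × ℝ))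
    MeasurableSet.univ (fun x _ => (LinearMap.toContinuousLinearMap L).hasFDerivAt.hasFDerivWithinAt)
    hbij.injective.injOn g
  have himage : (LinearMap.toContinuousLinearMap L) '' Set.univ = Set.univ := by
    rw [Set.image_univ]
    exact hbij.surjective.range_eq
  rw [himage, Measure.restrict_univ, integral_smul, LinearMap.det_toContinuousLinearMap, hdet] at h
  rw [h]
  simp [hL_apply]

/-- For an invertible grid matrix `Ξ` with columns `ξ₁, ξ₂` and `ξ₃ = ξ₁ + ξ₂`, the
Fourier transform of `B_Ξ(x) = φ(Ξ⁻¹x)` is `|det Ξ| ∏_{r=1}^3 sinc(ξᵣᵀω/2)`. -/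
theorem boxSpline_grid_fourier (Ξ : Matrix (Fin 2) (Fin 2) ℝ) (hΞ : IsUnit Ξ.det)
    (ω : ℝ × ℝ) :
    ft2 (fun x => boxSpline ((Ξ⁻¹.mulVec ![x.1, x.2]) 0, (Ξ⁻¹.mulVec ![x.1, x.2]) 1)) ω
      = ((|Ξ.det| *
          (sinc ((Ξ 0 0 * ω.1 + Ξ 1 0 * ω.2) / 2) *
            sinc ((Ξ 0 1 * ω.1 + Ξ 1 1 * ω.2) / 2) *
            sinc (((Ξ 0 0 + Ξ 0 1) * ω.1 + (Ξ 1 0 + Ξ 1 1) * ω.2) / 2)) : ℝ) : ℂ) := by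
  have h := ft2_boxSpline (Ξ 0 0 * ω.1 + Ξ 1 0 * ω.2, Ξ 0 1 * ω.1 + Ξ 1 1 * ω.2)
  have hsum : (Ξ 0 0 + Ξ 0 1) * ω.1 + (Ξ 1 0 + Ξ 1 1) * ω.2
      = Ξ 0 0 * ω.1 + Ξ 1 0 * ω.2 + (Ξ 0 1 * ω.1 + Ξ 1 1 * ω.2) := by ring
  rw [hsum, Complex.ofReal_mul, ← h, ft2, ft2,
    integral_eq_abs_det_smul_integral_mulVec Ξ hΞ, Complex.real_smul]
  congr 2
  funext y
  have hpair (v : Fin 2 → ℝ) : ![v 0, v 1] = v := by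
    ext i; fin_cases i <;> rfl
  dsimp only
  rw [hpair, Matrix.mulVec_mulVec, Matrix.nonsing_inv_mul _ hΞ, Matrix.one_mulVec]
  congr 4
  simp [Matrix.mulVec, dotProduct]
  ring
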